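/- arXiv:1808.10314 — 2 statements merged into one kernel-verified Lean document; each statement's English description precedes it below -/
import Mathlib

section
/- Every melonic SYK graph G satisfies F(G) = q + (q−1)·(|V(G)| − 2)/2. -/
namespace SYK

/-- A pre-SYK graph: a finite nonempty vertex set `V`, darts `V × Fin q`
(`Fin q` standing for the strand labels `{1,…,q}`), a fixed-point-free
involutive fermionic pairing `ferm` of the darts, and a fixed-point-free
involutive disorder pairing `dis` of the vertices.  (Connectivity of the
fermionic multigraph is *not* required.) -/
structure PreGraph (q : ℕ) where
  V : Type
  [fintypeV : Fintype V]
  [decEqV : DecidableEq V]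
  [nonemptyV : Nonempty V]
  ferm : Equiv.Perm (V × Fin q)
  dis : Equiv.Perm V
  ferm_invol : ∀ d, ferm (ferm d) = d
  ferm_fpf : ∀ d, ferm d ≠ d
  dis_invol : ∀ v, dis (dis v) = v
  dis_fpf : ∀ v, dis v ≠ v

attribute [instance] PreGraph.fintypeV PreGraph.decEqV PreGraph.nonemptyV

variable {q : ℕ}

/-- The darts of a pre-SYK graph. -/
abbrev PreGraph.Dart (H : PreGraph q) : Type := H.V × Fin q

/-- Relabelling of darts induced by a map of vertices. -/
def dartMap {q : ℕ} {α β : Type} (ι : α → β) (d : α × Fin q) : β × Fin q :=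
  (ι d.1, d.2)

/-- The involution `π̂` on darts induced by the disorder pairing:
`π̂ (v, m) = (π v, m)`. -/
def PreGraph.dishat (H : PreGraph q) : Equiv.Perm H.Dart :=
  Equiv.prodCongr H.dis (Equiv.refl (Fin q))

/-- Adjacency of vertices in the fermionic multigraph `G₀`, where fermionic
lines having a dart in `S` are deleted. -/
def PreGraph.adj0Off (H : PreGraph q) (S : Set H.Dart) (v w : H.V) : Prop :=
  ∃ m m' : Fin q, (v, m) ∉ S ∧ H.ferm (v, m) = (w, m')

/-- Adjacency of vertices in the fermionic multigraph `G₀`. -/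
def PreGraph.adj0 (H : PreGraph q) : H.V → H.V → Prop :=
  H.adj0Off ∅

/-- Connectivity of the fermionic multigraph `G₀`. -/
def PreGraph.Conn0 (H : PreGraph q) : Prop :=
  ∀ v w : H.V, Relation.ReflTransGen H.adj0 v w

/-- Adjacency of vertices in the multigraph `G⁺` (one edge per fermionic line
and one edge per disorder line), where fermionic lines having a dart in `S`
are deleted. -/
def PreGraph.adjPlusOff (H : PreGraph q) (S : Set H.Dart) (v w : H.V) : Prop :=
  H.adj0Off S v w ∨ H.dis v = w

/-- The subgroup of dart permutations generated by the fermionic pairing `τ`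
and the induced disorder involution `π̂`; faces are its orbits. -/
def PreGraph.faceGroup (H : PreGraph q) : Subgroup (Equiv.Perm H.Dart) :=
  Subgroup.closure {H.ferm, H.dishat}

/-- Two darts lie in a common face. -/
def PreGraph.SameFace (H : PreGraph q) (d₁ d₂ : H.Dart) : Prop :=
  d₁ ∈ MulAction.orbit H.faceGroup d₂

/-- `F H`: the number of faces, i.e. of orbits of `⟨τ, π̂⟩` on the darts. -/
noncomputable def PreGraph.F (H : PreGraph q) : ℕ :=
  Nat.card (MulAction.orbitRel.Quotient H.faceGroup H.Dart)

/-- The number of vertices `|V(H)|`. -/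
noncomputable def PreGraph.nV (H : PreGraph q) : ℕ :=
  Nat.card H.V

/-- `δ(H) = F(H) − (q−1)·|V(H)|/2` (the division is exact: `|V(H)|` is even). -/
noncomputable def PreGraph.delta (H : PreGraph q) : ℤ :=
  (H.F : ℤ) - ((q : ℤ) - 1) * ((H.nV / 2 : ℕ) : ℤ)

/-- `e` is a fermionic line: the set of the two darts of a `τ`-orbit. -/
def PreGraph.IsLine (H : PreGraph q) (e : Set H.Dart) : Prop :=
  ∃ d : H.Dart, e = {d, H.ferm d}

/-- The fermionic lines `e₁` and `e₂` belong to a common face. -/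
def PreGraph.LinesShareFace (H : PreGraph q) (e₁ e₂ : Set H.Dart) : Prop :=
  ∃ d₁ ∈ e₁, ∃ d₂ ∈ e₂, H.SameFace d₁ d₂

/-- Deleting the fermionic lines with a dart in `S` disconnects `G₀`. -/
def PreGraph.Disconnects0 (H : PreGraph q) (S : Set H.Dart) : Prop :=
  ¬ ∀ v w : H.V, Relation.ReflTransGen (H.adj0Off S) v w

/-- Deleting the fermionic lines with a dart in `S` disconnects `G⁺`. -/
def PreGraph.DisconnectsPlus (H : PreGraph q) (S : Set H.Dart) : Prop :=
  ¬ ∀ v w : H.V, Relation.ReflTransGen (H.adjPlusOff S) v w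

/-- `{e₁, e₂}` is a 2-cut of the multigraph `G⁺`. -/
def PreGraph.TwoCutPlus (H : PreGraph q) (e₁ e₂ : Set H.Dart) : Prop :=
  H.DisconnectsPlus (e₁ ∪ e₂)

/-- `{e₁, e₂}` is a 2-cut of the fermionic multigraph `G₀`. -/
def PreGraph.TwoCut0 (H : PreGraph q) (e₁ e₂ : Set H.Dart) : Prop :=
  H.Disconnects0 (e₁ ∪ e₂)

/-- An SYK graph: a pre-SYK graph whose fermionic multigraph `G₀` is
connected. -/
structure Graph (q : ℕ) extends PreGraph q where
  conn : toPreGraph.Conn0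

/-- `G` is (a relabelling of) the minimal graph `G_min`: two vertices `a, b`
with `π a = b` and `τ (a, m) = (b, m)` for all `m`. -/
def Graph.IsMin (G : Graph q) : Prop :=
  ∃ a b : G.V, a ≠ b ∧ (∀ v : G.V, v = a ∨ v = b) ∧ G.dis a = b ∧
    ∀ m : Fin q, G.ferm (a, m) = (b, m)

/-- `G'` is obtained from `G` by a melonic move: two new vertices `x, y` with
`π x = y` are inserted on a fermionic line `{d, τ d}` of `G`; the strand
`⟨0, _⟩ : Fin q` plays the role of the label `1` of `{1,…,q}`. -/
def Graph.MelonicMove (G G' : Graph q) : Prop :=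
  ∃ (x y : G'.V) (ι : G.V → G'.V) (d : G.V × Fin q),
    Function.Injective ι ∧ x ≠ y ∧
    (∀ v' : G'.V, (¬ ∃ v, ι v = v') ↔ (v' = x ∨ v' = y)) ∧
    G'.dis x = y ∧
    (∀ v, G'.dis (ι v) = ι (G.dis v)) ∧
    G'.ferm (dartMap ι d) = (x, ⟨0, d.2.pos⟩) ∧
    G'.ferm (y, ⟨0, d.2.pos⟩) = dartMap ι (G.ferm d) ∧
    (∀ k : Fin q, k ≠ ⟨0, d.2.pos⟩ → G'.ferm (x, k) = (y, k)) ∧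
    (∀ d' : G.V × Fin q, d' ≠ d → d' ≠ G.ferm d →
      G'.ferm (dartMap ι d') = dartMap ι (G.ferm d'))

/-- Isomorphism of SYK graphs: a bijection of darts commuting with the
fermionic pairings and the induced disorder involutions, and mapping the `q`
darts of each vertex onto the `q` darts of a single vertex. -/
def Graph.Isomorphic (G G' : Graph q) : Prop :=
  ∃ φ : (G.V × Fin q) ≃ (G'.V × Fin q),
    (∀ d, φ (G.ferm d) = G'.ferm (φ d)) ∧
    (∀ d, φ (G.toPreGraph.dishat d) = G'.toPreGraph.dishat (φ d)) ∧
    ∀ v : G.V, ∃ v' : G'.V, ∀ m : Fin q, (φ (v, m)).1 = v'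

/-- `G` is melonic: isomorphic to a graph obtained from the minimal graph
`G_min` by a finite sequence of melonic moves. -/
def Graph.IsMelonic (G : Graph q) : Prop :=
  ∃ G₀ Gn : Graph q, G₀.IsMin ∧ Relation.ReflTransGen Graph.MelonicMove G₀ Gn ∧
    G.Isomorphic Gn


/-- The pre-SYK graph obtained from `H` by replacing the fermionic pairing,
keeping the vertex set and the disorder pairing. -/
def PreGraph.withFerm (H : PreGraph q) (f : Equiv.Perm (H.V × Fin q))
    (hi : ∀ d, f (f d) = d) (hf : ∀ d, f d ≠ d) : PreGraph q where
  V := H.V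
  fintypeV := H.fintypeV
  decEqV := H.decEqV
  nonemptyV := H.nonemptyV
  ferm := f
  dis := H.dis
  ferm_invol := hi
  ferm_fpf := hf
  dis_invol := H.dis_invol
  dis_fpf := H.dis_fpf

/-- `G` is the gluing `G₁^{(e₁)} ⋆ G₂^{(e₂)}` where `e₁ = {d₁, τ₁ d₁}` and
`e₂ = {d₂, τ₂ d₂}`: the vertex set is the disjoint union of those of `G₁` and
`G₂`, the disorder pairing is the union of the two disorder pairings, and the
fermionic pairing agrees with `τ₁`, `τ₂` outside `e₁ ∪ e₂` and pairs `d₁` with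
`d₂`, and `τ₁ d₁` with `τ₂ d₂`. -/
def Graph.IsStarGluing (G₁ G₂ G : Graph q) (d₁ : G₁.V × Fin q)
    (d₂ : G₂.V × Fin q) : Prop :=
  ∃ (ι₁ : G₁.V → G.V) (ι₂ : G₂.V → G.V),
    Function.Injective ι₁ ∧ Function.Injective ι₂ ∧
    (∀ v₁ v₂, ι₁ v₁ ≠ ι₂ v₂) ∧
    (∀ v : G.V, (∃ v₁, ι₁ v₁ = v) ∨ (∃ v₂, ι₂ v₂ = v)) ∧
    (∀ v, G.dis (ι₁ v) = ι₁ (G₁.dis v)) ∧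
    (∀ v, G.dis (ι₂ v) = ι₂ (G₂.dis v)) ∧
    G.ferm (dartMap ι₁ d₁) = dartMap ι₂ d₂ ∧
    G.ferm (dartMap ι₁ (G₁.ferm d₁)) = dartMap ι₂ (G₂.ferm d₂) ∧
    (∀ d, d ≠ d₁ → d ≠ G₁.ferm d₁ →
      G.ferm (dartMap ι₁ d) = dartMap ι₁ (G₁.ferm d)) ∧
    (∀ d, d ≠ d₂ → d ≠ G₂.ferm d₂ →
      G.ferm (dartMap ι₂ d) = dartMap ι₂ (G₂.ferm d))

/-- `G` is the gluing `G₁^{(e₁)} ⋆̄ G₂^{(e₂)}`: as in `IsStarGluing` but the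
fermionic pairing pairs `d₁` with `τ₂ d₂`, and `τ₁ d₁` with `d₂`. -/
def Graph.IsBarGluing (G₁ G₂ G : Graph q) (d₁ : G₁.V × Fin q)
    (d₂ : G₂.V × Fin q) : Prop :=
  ∃ (ι₁ : G₁.V → G.V) (ι₂ : G₂.V → G.V),
    Function.Injective ι₁ ∧ Function.Injective ι₂ ∧
    (∀ v₁ v₂, ι₁ v₁ ≠ ι₂ v₂) ∧
    (∀ v : G.V, (∃ v₁, ι₁ v₁ = v) ∨ (∃ v₂, ι₂ v₂ = v)) ∧
    (∀ v, G.dis (ι₁ v) = ι₁ (G₁.dis v)) ∧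
    (∀ v, G.dis (ι₂ v) = ι₂ (G₂.dis v)) ∧
    G.ferm (dartMap ι₁ d₁) = dartMap ι₂ (G₂.ferm d₂) ∧
    G.ferm (dartMap ι₁ (G₁.ferm d₁)) = dartMap ι₂ d₂ ∧
    (∀ d, d ≠ d₁ → d ≠ G₁.ferm d₁ →
      G.ferm (dartMap ι₁ d) = dartMap ι₁ (G₁.ferm d)) ∧
    (∀ d, d ≠ d₂ → d ≠ G₂.ferm d₂ →
      G.ferm (dartMap ι₂ d) = dartMap ι₂ (G₂.ferm d))

/-- `H''` is the contraction of the disorder line `{v, w}` of `H`: its vertex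
set is `V(H) ∖ {v, w}` (embedded via `ι`), its disorder pairing is the
restriction of that of `H`, and its fermionic pairing pairs `τ (v, m)` with
`τ (w, m)` for each strand `m` and agrees with `τ` on all other darts. -/
def PreGraph.IsContraction (H H'' : PreGraph q) (v w : H.V) : Prop :=
  ∃ ι : H''.V → H.V,
    Function.Injective ι ∧
    (∀ u : H.V, (∃ u'', ι u'' = u) ↔ (u ≠ v ∧ u ≠ w)) ∧
    (∀ u, ι (H''.dis u) = H.dis (ι u)) ∧
    (∀ m : Fin q, ∃ a b : H''.V × Fin q,
      dartMap ι a = H.ferm (v, m) ∧ dartMap ι b = H.ferm (w, m) ∧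
      H''.ferm a = b) ∧
    (∀ d : H''.V × Fin q,
      (∀ m : Fin q, dartMap ι d ≠ H.ferm (v, m) ∧ dartMap ι d ≠ H.ferm (w, m)) →
      dartMap ι (H''.ferm d) = H.ferm (dartMap ι d))

/-- `HL` is the closure of the side `side ⊆ V(G)` of the graph `G` cut along
the fermionic lines `e₁, e₂`: its vertex set is `{v | side v}` (embedded via
`ι`), its disorder pairing is the restriction of that of `G`, and its
fermionic pairing pairs the `side`-dart of `e₁` with the `side`-dart of `e₂`
and agrees with `τ` on all darts not in `e₁ ∪ e₂`. -/
def Graph.IsSideClose (G : Graph q) (side : G.V → Prop)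
    (e₁ e₂ : Set (G.V × Fin q)) (HL : PreGraph q) : Prop :=
  ∃ ι : HL.V → G.V,
    Function.Injective ι ∧
    (∀ v : G.V, (∃ u, ι u = v) ↔ side v) ∧
    (∀ u, ι (HL.dis u) = G.dis (ι u)) ∧
    (∃ a b : HL.V × Fin q, dartMap ι a ∈ e₁ ∧ dartMap ι b ∈ e₂ ∧
      HL.ferm a = b) ∧
    (∀ d : HL.V × Fin q, dartMap ι d ∉ e₁ ∪ e₂ →
      dartMap ι (HL.ferm d) = G.ferm (dartMap ι d))


/-- The faces of a pre-SYK graph. -/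
abbrev PreGraph.Face (H : PreGraph q) : Type :=
  MulAction.orbitRel.Quotient H.faceGroup H.Dart

/-- The face through a dart. -/
def PreGraph.face (H : PreGraph q) (d : H.Dart) : H.Face :=
  Quotient.mk (MulAction.orbitRel H.faceGroup H.Dart) d

namespace PreGraph

variable (H : PreGraph q)

theorem face_surjective : Function.Surjective H.face :=
  Quotient.mk_surjective

theorem face_ferm (d : H.Dart) : H.face (H.ferm d) = H.face d :=
  Quotient.sound (s := MulAction.orbitRel H.faceGroup H.Dart)
    ⟨⟨H.ferm, Subgroup.subset_closure (Or.inl rfl)⟩, rfl⟩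

theorem face_dis (v : H.V) (m : Fin q) : H.face (H.dis v, m) = H.face (v, m) :=
  Quotient.sound (s := MulAction.orbitRel H.faceGroup H.Dart)
    ⟨⟨H.dishat, Subgroup.subset_closure (Or.inr rfl)⟩, rfl⟩

/-- A function on darts invariant under both pairings factors through the faces. -/
theorem exists_face_lift {α : Type*} (f : H.Dart → α) (hf : ∀ d, f (H.ferm d) = f d)
    (hd : ∀ v m, f (H.dis v, m) = f (v, m)) : ∃ g : H.Face → α, ∀ d, g (H.face d) = f d := by
  have key : ∀ σ ∈ H.faceGroup, ∀ d, f (σ d) = f d := by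
    intro σ hσ
    induction hσ using Subgroup.closure_induction with
    | mem σ hσ =>
      rcases hσ with rfl | rfl
      · exact hf
      · exact fun d => hd d.1 d.2
    | one => exact fun _ => rfl
    | mul σ ρ _ _ h₁ h₂ => exact fun d => (h₁ (ρ d)).trans (h₂ d)
    | inv σ _ h => exact fun d => by simpa using (h (σ⁻¹ d)).symm
  refine ⟨Quotient.lift f ?_, fun _ => rfl⟩
  rintro a b ⟨⟨σ, hσ⟩, rfl⟩
  exact key σ hσ b

/-- A complete, irredundant labelling of the faces counts them. -/
theorem F_eq_card {α : Type*} (f : H.Dart → α) (hf : ∀ d, f (H.ferm d) = f d)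
    (hd : ∀ v m, f (H.dis v, m) = f (v, m)) (s : α → H.Face)
    (hs : ∀ d, s (f d) = H.face d) (hfs : Function.Surjective f) : H.F = Nat.card α := by
  obtain ⟨g, hg⟩ := H.exists_face_lift f hf hd
  refine Nat.card_congr ⟨g, s, fun c => ?_, fun a => ?_⟩
  · obtain ⟨d, rfl⟩ := H.face_surjective c
    rw [hg, hs]
  · obtain ⟨d, rfl⟩ := hfs a
    rw [hs, hg]

end PreGraph

namespace Graph

theorem IsMin.nV_eq {G : Graph q} (h : G.IsMin) : G.toPreGraph.nV = 2 := by
  obtain ⟨a, b, hab, hall, -, -⟩ := h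
  refine Nat.card_eq_two_iff.2 ⟨a, b, hab, ?_⟩
  ext v
  simpa using hall v

theorem IsMin.F_eq {G : Graph q} (h : G.IsMin) : G.toPreGraph.F = q := by
  obtain ⟨a, b, -, hall, hdis, hferm⟩ := h
  have hferm' : ∀ m, G.ferm (b, m) = (a, m) := fun m => by rw [← hferm m, G.ferm_invol]
  have := G.toPreGraph.F_eq_card (fun d => d.2) ?_ (fun _ _ => rfl)
    (fun m => G.toPreGraph.face (a, m)) ?_ (fun m => ⟨(a, m), rfl⟩)
  · simpa using this
  · rintro ⟨v, m⟩
    rcases hall v with rfl | rfl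
    · simp [hferm]
    · simp [hferm']
  · rintro ⟨v, m⟩
    rcases hall v with rfl | rfl
    · rfl
    · simp only [← hdis, G.toPreGraph.face_dis]

theorem Isomorphic.nV_eq {G G' : Graph q} (hq : 0 < q) (h : G.Isomorphic G') :
    G.toPreGraph.nV = G'.toPreGraph.nV := by
  obtain ⟨φ, -⟩ := h
  have := Nat.card_congr φ
  simp only [Nat.card_prod, Nat.card_fin] at this
  exact Nat.eq_of_mul_eq_mul_right hq this

theorem Isomorphic.F_eq {G G' : Graph q} (h : G.Isomorphic G') :
    G.toPreGraph.F = G'.toPreGraph.F := by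
  obtain ⟨φ, hferm, hdis, -⟩ := h
  have hdis' : ∀ d, φ.symm (G'.toPreGraph.dishat d) = G.toPreGraph.dishat (φ.symm d) := fun d => by
    rw [Equiv.symm_apply_eq, hdis, φ.apply_symm_apply]
  have hferm' : ∀ d, φ.symm (G'.ferm d) = G.ferm (φ.symm d) := fun d => by
    rw [Equiv.symm_apply_eq, hferm, φ.apply_symm_apply]
  obtain ⟨s, hs⟩ := G'.toPreGraph.exists_face_lift (fun d => G.toPreGraph.face (φ.symm d))
    (fun d => by rw [hferm', G.toPreGraph.face_ferm])
    (fun v m => (congrArg G.toPreGraph.face (hdis' (v, m))).trans (G.toPreGraph.face_dis _ _))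
  exact G.toPreGraph.F_eq_card (fun d => G'.toPreGraph.face (φ d))
    (fun d => by rw [hferm, G'.toPreGraph.face_ferm])
    (fun v m => (congrArg G'.toPreGraph.face (hdis (v, m))).trans (G'.toPreGraph.face_dis _ _))
    s (fun d => by rw [hs, φ.symm_apply_apply])
    (G'.toPreGraph.face_surjective.comp φ.surjective)

theorem MelonicMove.nV_eq {G G' : Graph q} (h : G.MelonicMove G') :
    G'.toPreGraph.nV = G.toPreGraph.nV + 2 := by
  obtain ⟨x, y, ι, -, hι, hxy, hrange, -⟩ := h
  have hcompl : (Set.range ι)ᶜ = {x, y} := Set.ext hrange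
  have := Set.ncard_add_ncard_compl (Set.range ι)
  rw [hcompl, Set.ncard_pair hxy, Set.ncard_range_of_injective hι] at this
  exact this.symm

theorem MelonicMove.F_eq {G G' : Graph q} (h : G.MelonicMove G') :
    G'.toPreGraph.F = G.toPreGraph.F + (q - 1) := by
  classical
  obtain ⟨x, y, ι, d, hι, hxy, hrange, hxd, hdis, hfd, hfy, hfk, hfo⟩ := h
  set z : Fin q := ⟨0, d.2.pos⟩
  have hyd : G'.dis y = x := by rw [← hxd, G'.dis_invol]
  have hfx : G'.ferm (x, z) = dartMap ι d := by rw [← hfd, G'.ferm_invol]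
  have hfd' : G'.ferm (dartMap ι (G.ferm d)) = (y, z) := by rw [← hfy, G'.ferm_invol]
  have hfk' : ∀ k, k ≠ z → G'.ferm (y, k) = (x, k) := fun k hk => by
    rw [← hfk k hk, G'.ferm_invol]
  have hx : ¬ ∃ v, ι v = x := (hrange x).2 (Or.inl rfl)
  have hy : ¬ ∃ v, ι v = y := (hrange y).2 (Or.inr rfl)
  have hcases : ∀ v', (∃ v, ι v = v') ∨ v' = x ∨ v' = y := fun v' =>
    (em _).imp_right (hrange v').1
  let f : G'.V × Fin q → G.toPreGraph.Face ⊕ {k : Fin q // k ≠ z} := fun p =>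
    if hp : ∃ v, ι v = p.1 then Sum.inl (G.toPreGraph.face (hp.choose, p.2))
    else if hk : p.2 = z then Sum.inl (G.toPreGraph.face d)
    else Sum.inr ⟨p.2, hk⟩
  have f_old : ∀ e, f (dartMap ι e) = Sum.inl (G.toPreGraph.face e) := by
    rintro ⟨v, m⟩
    have hp : ∃ w, ι w = ι v := ⟨v, rfl⟩
    have hv : hp.choose = v := hι hp.choose_spec
    simp only [f, dartMap]
    rw [dif_pos hp, hv]
  have f_z : ∀ v', (¬ ∃ v, ι v = v') → f (v', z) = Sum.inl (G.toPreGraph.face d) := by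
    intro v' hv'
    simp only [f]
    rw [dif_neg hv', dif_pos trivial]
  have f_k : ∀ v', (¬ ∃ v, ι v = v') → ∀ k (hk : k ≠ z), f (v', k) = Sum.inr ⟨k, hk⟩ := by
    intro v' hv' k hk
    simp only [f]
    rw [dif_neg hv', dif_neg hk]
  have f_new : ∀ k, f (x, k) = f (y, k) := by
    intro k
    by_cases hk : k = z
    · rw [hk, f_z x hx, f_z y hy]
    · rw [f_k x hx k hk, f_k y hy k hk]
  have face_xy : ∀ k, G'.toPreGraph.face (y, k) = G'.toPreGraph.face (x, k) := fun k => by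
    rw [← hxd, G'.toPreGraph.face_dis]
  have face_xz : G'.toPreGraph.face (x, z) = G'.toPreGraph.face (dartMap ι d) := by
    rw [← hfd, G'.toPreGraph.face_ferm]
  have face_yz : G'.toPreGraph.face (dartMap ι (G.ferm d)) = G'.toPreGraph.face (y, z) := by
    rw [← hfy, G'.toPreGraph.face_ferm]
  obtain ⟨s, hs⟩ := G.toPreGraph.exists_face_lift (fun e => G'.toPreGraph.face (dartMap ι e))
    (fun e => by
      by_cases h₁ : e = d
      · rw [h₁, face_yz, face_xy, face_xz]
      · by_cases h₂ : e = G.ferm d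
        · rw [h₂, G.ferm_invol, face_yz, face_xy, face_xz]
        · rw [← hfo e h₁ h₂, G'.toPreGraph.face_ferm])
    (fun v m => by simp only [dartMap, ← hdis, G'.toPreGraph.face_dis])
  have hcard := G'.toPreGraph.F_eq_card f ?_ ?_
    (Sum.elim s fun k => G'.toPreGraph.face (x, k.1)) ?_ ?_
  · rw [hcard, Nat.card_sum]
    congr 1
    simp
  · rintro ⟨v', m⟩
    rcases hcases v' with ⟨v, rfl⟩ | rfl | rfl
    · change f (G'.ferm (dartMap ι (v, m))) = f (dartMap ι (v, m))
      by_cases h₁ : (v, m) = d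
      · rw [h₁, hfd, f_z x hx, f_old]
      · by_cases h₂ : (v, m) = G.ferm d
        · rw [h₂, hfd', f_z y hy, f_old, G.toPreGraph.face_ferm]
        · rw [hfo _ h₁ h₂, f_old, f_old, G.toPreGraph.face_ferm]
    · by_cases hk : m = z
      · rw [hk, hfx, f_old, f_z _ hx]
      · rw [hfk m hk, f_new]
    · by_cases hk : m = z
      · rw [hk, hfy, f_old, f_z _ hy, G.toPreGraph.face_ferm]
      · rw [hfk' m hk, f_new]
  · intro v' m
    rcases hcases v' with ⟨v, rfl⟩ | rfl | rfl
    · rw [hdis]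
      change f (dartMap ι (G.dis v, m)) = f (dartMap ι (v, m))
      rw [f_old, f_old, G.toPreGraph.face_dis]
    · rw [hxd, f_new]
    · rw [hyd, f_new]
  · have hsx : ∀ k, Sum.elim s (fun k => G'.toPreGraph.face (x, k.1)) (f (x, k)) =
        G'.toPreGraph.face (x, k) := by
      intro k
      by_cases hk : k = z
      · rw [hk, f_z x hx, Sum.elim_inl, hs, face_xz]
      · rw [f_k x hx k hk, Sum.elim_inr]
    rintro ⟨v', m⟩
    rcases hcases v' with ⟨v, rfl⟩ | rfl | rfl
    · change Sum.elim s _ (f (dartMap ι (v, m))) = G'.toPreGraph.face (dartMap ι (v, m))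
      rw [f_old, Sum.elim_inl, hs]
    · exact hsx m
    · rw [← f_new, face_xy, hsx]
  · rintro (c | ⟨k, hk⟩)
    · obtain ⟨e, rfl⟩ := G.toPreGraph.face_surjective c
      exact ⟨_, f_old e⟩
    · exact ⟨_, f_k x hx k hk⟩

end Graph

/-- Every melonic SYK graph `G` satisfies
`F(G) = q + (q−1)·(|V(G)| − 2)/2`. -/
theorem syk_melonic_face_count (q : ℕ) (hq : 2 ≤ q) (G : Graph q)
    (h : G.IsMelonic) :
    G.toPreGraph.F = q + (q - 1) * ((G.toPreGraph.nV - 2) / 2) := by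
  obtain ⟨G₀, Gn, hmin, hmoves, hiso⟩ := h
  have key : ∃ n, Gn.toPreGraph.nV = 2 * n + 2 ∧ Gn.toPreGraph.F = q + (q - 1) * n := by
    clear hiso
    induction hmoves with
    | refl => exact ⟨0, hmin.nV_eq, hmin.F_eq⟩
    | tail _ hmove ih =>
      obtain ⟨n, hV, hF⟩ := ih
      exact ⟨n + 1, by rw [hmove.nV_eq, hV]; ring, by rw [hmove.F_eq, hF]; ring⟩
  obtain ⟨n, hV, hF⟩ := key
  rw [hiso.F_eq, hiso.nV_eq (by lia), hV, hF]
  simp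

end SYK
end

section
/- Let q ≥ 2, let G be an SYK graph and let e₁ ≠ e₂ be fermionic lines of G belonging to a common face. Suppose V(G) is partitioned as V_L ⊔ V_R such that each of e₁ and e₂ has exactly one dart in V_L × {1,…,q}, and no fermionic line other than e₁, e₂ and no disorder line joins a vertex of V_L to a vertex of V_R. Let G_L have vertex set V_L, disorder pairing the restriction of π, and fermionic pairing agreeing with τ on all darts not in e₁ ∪ e₂ and pairing the V_L-dart of e₁ with the V_L-dart of e₂; define G_R analogously on V_R. Then G_L and G_R are SYK graphs (in particular their fermionic multigraphs (G_L)₀ and (G_R)₀ are connected) and F(G) = F(G_L) + F(G_R) − 1. -/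
namespace SYK

variable {q : ℕ}

/-- A walk for `r` starting in the image of `ι` (which is the side `Q`) projects to the relation `s`,
provided every step inside `Q` does and every step crossing out of or into `Q` uses a point
`s`-related to `a`. -/
theorem reflTransGen_lift_side {X Y : Type} {r : X → X → Prop} {Q : X → Prop} {ι : Y → X}
    {s : Y → Y → Prop} (hs : Equivalence s) (hι : Function.Injective ι)
    (hQ : ∀ x, (∃ u, ι u = x) ↔ Q x) {a : Y}
    (inside : ∀ u w, r (ι u) (ι w) → s u w)
    (leave : ∀ u y, r (ι u) y → ¬ Q y → s u a)
    (enter : ∀ x w, r x (ι w) → ¬ Q x → s a w)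
    {u : Y} {y : X} (h : Relation.ReflTransGen r (ι u) y) :
    (∀ w, ι w = y → s u w) ∧ (¬ Q y → s u a) := by
  induction h with
  | refl =>
    exact ⟨fun w hw => hι hw ▸ hs.refl _, fun hn => absurd ((hQ _).1 ⟨u, rfl⟩) hn⟩
  | @tail x y _ hxy ih =>
    by_cases hx : Q x
    · obtain ⟨t, rfl⟩ := (hQ x).2 hx
      refine ⟨?_, fun hy => hs.trans (ih.1 t rfl) (leave t y hxy hy)⟩
      rintro w rfl
      exact hs.trans (ih.1 t rfl) (inside t w hxy)
    · refine ⟨?_, fun _ => ih.2 hx⟩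
      rintro w rfl
      exact hs.trans (ih.2 hx) (enter x w hxy hx)

/-- Inclusion–exclusion for two injections covering a finite type and overlapping in one point. -/
theorem card_add_one_of_cover {X Y Z : Type*} [Finite X] {f : Y → X} {g : Z → X}
    (hf : Function.Injective f) (hg : Function.Injective g) {c : X}
    (hcover : Set.range f ∪ Set.range g = Set.univ) (hmeet : Set.range f ∩ Set.range g = {c}) :
    Nat.card X + 1 = Nat.card Y + Nat.card Z := by
  have h := Set.ncard_union_add_ncard_inter (Set.range f) (Set.range g)
  rwa [hcover, hmeet, Set.ncard_univ, Set.ncard_singleton, ← Nat.card_coe_set_eq (Set.range f),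
    ← Nat.card_coe_set_eq (Set.range g), Nat.card_range_of_injective hf,
    Nat.card_range_of_injective hg] at h

theorem PreGraph.dishat_dishat (H : PreGraph q) (d : H.Dart) : H.dishat (H.dishat d) = d :=
  Prod.ext (H.dis_invol d.1) rfl

theorem PreGraph.sameFace_equivalence (H : PreGraph q) : Equivalence H.SameFace :=
  (MulAction.orbitRel H.faceGroup H.Dart).iseqv

theorem PreGraph.sameFace_ferm (H : PreGraph q) (d : H.Dart) : H.SameFace (H.ferm d) d :=
  ⟨⟨H.ferm, Subgroup.subset_closure (by simp)⟩, rfl⟩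

theorem PreGraph.sameFace_dishat (H : PreGraph q) (d : H.Dart) : H.SameFace (H.dishat d) d :=
  ⟨⟨H.dishat, Subgroup.subset_closure (by simp)⟩, rfl⟩

/-- Being in a common face is the least equivalence relation relating each dart to its images
under the fermionic pairing and under the disorder involution. -/
theorem PreGraph.SameFace.of_equivalence {H : PreGraph q} {s : H.Dart → H.Dart → Prop}
    (hs : Equivalence s) (hf : ∀ d, s (H.ferm d) d) (hd : ∀ d, s (H.dishat d) d)
    {d₁ d₂ : H.Dart} (h : H.SameFace d₁ d₂) : s d₁ d₂ := by
  obtain ⟨⟨g, hg⟩, rfl⟩ := h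
  change s (g d₂) d₂
  induction hg using Subgroup.closure_induction generalizing d₂ with
  | mem x hx =>
    rcases hx with rfl | rfl
    · exact hf d₂
    · exact hd d₂
  | one => exact hs.refl _
  | mul x y _ _ hx hy => exact hs.trans hx hy
  | inv x _ hx => exact hs.symm (by simpa using hx (d₂ := x⁻¹ d₂))

/-- One step along a face: an application of the fermionic pairing or the disorder involution. -/
def PreGraph.FaceStep (H : PreGraph q) (d d' : H.Dart) : Prop :=
  H.ferm d = d' ∨ H.dishat d = d'

theorem PreGraph.SameFace.reflTransGen {H : PreGraph q} {d₁ d₂ : H.Dart}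
    (h : H.SameFace d₁ d₂) : Relation.ReflTransGen H.FaceStep d₁ d₂ := by
  have symm : ∀ d d', H.FaceStep d d' → H.FaceStep d' d := by
    rintro d _ (rfl | rfl)
    · exact .inl (H.ferm_invol d)
    · exact .inr (H.dishat_dishat d)
  refine h.of_equivalence ⟨fun _ => .refl, fun h => ?_, fun h h' => h.trans h'⟩
    (fun d => .single (.inl (H.ferm_invol d))) (fun d => .single (.inr (H.dishat_dishat d)))
  exact Relation.ReflTransGen.mono (fun _ _ => symm _ _) _ _ (Relation.ReflTransGen.swap _ _ h)

theorem PreGraph.adj0_ferm (H : PreGraph q) (d : H.Dart) : H.adj0 d.1 (H.ferm d).1 :=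
  ⟨d.2, (H.ferm d).2, by simp, rfl⟩

theorem PreGraph.adj0_iff (H : PreGraph q) {v w : H.V} :
    H.adj0 v w ↔ ∃ d : H.Dart, d.1 = v ∧ (H.ferm d).1 = w := by
  constructor
  · rintro ⟨m, m', -, h⟩
    exact ⟨(v, m), rfl, by rw [h]⟩
  · rintro ⟨d, rfl, rfl⟩
    exact H.adj0_ferm d

theorem PreGraph.reach0_equivalence (H : PreGraph q) :
    Equivalence (Relation.ReflTransGen H.adj0) := by
  refine ⟨fun _ => .refl, fun h => ?_, fun h h' => h.trans h'⟩
  refine Relation.ReflTransGen.mono ?_ _ _ (Relation.ReflTransGen.swap _ _ h)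
  intro v w h
  obtain ⟨d, rfl, rfl⟩ := H.adj0_iff.1 h
  simpa [H.ferm_invol] using H.adj0_ferm (H.ferm d)

theorem PreGraph.IsLine.ferm_mem {H : PreGraph q} {e : Set H.Dart} (he : H.IsLine e) {d : H.Dart}
    (hd : d ∈ e) : H.ferm d ∈ e := by
  obtain ⟨c, rfl⟩ := he
  rcases hd with rfl | rfl
  · exact .inr rfl
  · exact .inl (H.ferm_invol c)

theorem PreGraph.IsLine.sameFace {H : PreGraph q} {e : Set H.Dart} (he : H.IsLine e)
    {d d' : H.Dart} (hd : d ∈ e) (hd' : d' ∈ e) : H.SameFace d d' := by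
  have hs := H.sameFace_equivalence
  obtain ⟨c, rfl⟩ := he
  have key : ∀ x ∈ ({c, H.ferm c} : Set H.Dart), H.SameFace x c := by
    rintro x (rfl | rfl)
    · exact hs.refl _
    · exact H.sameFace_ferm _
  exact hs.trans (key d hd) (hs.symm (key d' hd'))

/-- A line with exactly one dart satisfying `Q` has exactly one dart violating it. -/
theorem PreGraph.IsLine.existsUnique_not {H : PreGraph q} {e : Set H.Dart} (he : H.IsLine e)
    {Q : H.V → Prop} (hQ : ∃! d, d ∈ e ∧ Q d.1) : ∃! d, d ∈ e ∧ ¬ Q d.1 := by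
  obtain ⟨c, ⟨hc, hcQ⟩, huniq⟩ := hQ
  refine ⟨H.ferm c, ⟨he.ferm_mem hc, fun h => H.ferm_fpf c (huniq _ ⟨he.ferm_mem hc, h⟩)⟩, ?_⟩
  rintro d ⟨hd, hdQ⟩
  obtain ⟨x, rfl⟩ := he
  have hdc : d ≠ c := by
    rintro rfl
    exact hdQ hcQ
  rcases hc with rfl | rfl <;> rcases hd with rfl | rfl
  · exact absurd rfl hdc
  · rfl
  · exact (H.ferm_invol _).symm
  · exact absurd rfl hdc

theorem dartMap_injective {α β : Type} {ι : α → β} (hι : Function.Injective ι) :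
    Function.Injective (dartMap (q := q) ι) := by
  intro d d' h
  obtain ⟨h₁, h₂⟩ := Prod.ext_iff.1 h
  exact Prod.ext (hι h₁) h₂

/-- The side `Q` of a graph is cut off by the two lines `e₁`, `e₂`. -/
structure PreGraph.IsCutSide (G : PreGraph q) (Q : G.V → Prop) (e₁ e₂ : Set G.Dart) : Prop where
  line₁ : G.IsLine e₁
  line₂ : G.IsLine e₂
  unique₁ : ∃! d, d ∈ e₁ ∧ Q d.1
  unique₂ : ∃! d, d ∈ e₂ ∧ Q d.1
  ferm_iff : ∀ d, d ∉ e₁ ∪ e₂ → (Q d.1 ↔ Q (G.ferm d).1)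
  dis_iff : ∀ v, Q v ↔ Q (G.dis v)

/-- The data of a closure `H` of the side `Q` of `G`, with chosen embedding and end darts. -/
structure PreGraph.IsClosure (G : PreGraph q) (Q : G.V → Prop) (e₁ e₂ : Set G.Dart)
    (H : PreGraph q) (ι : H.V → G.V) (a : H.Dart) : Prop extends G.IsCutSide Q e₁ e₂ where
  inj : Function.Injective ι
  range_iff : ∀ v, (∃ u, ι u = v) ↔ Q v
  map_dis : ∀ u, ι (H.dis u) = G.dis (ι u)
  mem₁ : dartMap ι a ∈ e₁
  mem₂ : dartMap ι (H.ferm a) ∈ e₂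
  map_ferm : ∀ d, dartMap ι d ∉ e₁ ∪ e₂ → dartMap ι (H.ferm d) = G.ferm (dartMap ι d)

namespace PreGraph

theorem IsCutSide.not {G : PreGraph q} {Q : G.V → Prop} {e₁ e₂ : Set G.Dart}
    (h : G.IsCutSide Q e₁ e₂) : G.IsCutSide (fun v => ¬ Q v) e₁ e₂ where
  line₁ := h.line₁
  line₂ := h.line₂
  unique₁ := h.line₁.existsUnique_not h.unique₁
  unique₂ := h.line₂.existsUnique_not h.unique₂
  ferm_iff d hd := not_congr (h.ferm_iff d hd)
  dis_iff v := not_congr (h.dis_iff v)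

/-- A line both of whose darts lie on the same side is not one of the cut lines. -/
theorem IsCutSide.notMem {G : PreGraph q} {Q : G.V → Prop} {e₁ e₂ : Set G.Dart}
    (h : G.IsCutSide Q e₁ e₂) {d : G.Dart} (hd : Q d.1) (hd' : Q (G.ferm d).1) :
    d ∉ e₁ ∪ e₂ := by
  rintro (hm | hm)
  · exact G.ferm_fpf d (h.unique₁.unique ⟨h.line₁.ferm_mem hm, hd'⟩ ⟨hm, hd⟩)
  · exact G.ferm_fpf d (h.unique₂.unique ⟨h.line₂.ferm_mem hm, hd'⟩ ⟨hm, hd⟩)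

namespace IsClosure

variable {G H : PreGraph q} {Q : G.V → Prop} {e₁ e₂ : Set G.Dart} {ι : H.V → G.V} {a : H.Dart}

theorem side (h : G.IsClosure Q e₁ e₂ H ι a) (u : H.V) : Q (ι u) :=
  (h.range_iff _).1 ⟨u, rfl⟩

theorem dart_range_iff (h : G.IsClosure Q e₁ e₂ H ι a) (d : G.Dart) :
    (∃ c : H.Dart, dartMap ι c = d) ↔ Q d.1 := by
  constructor
  · rintro ⟨c, rfl⟩
    exact h.side c.1
  · intro hd
    obtain ⟨u, hu⟩ := (h.range_iff _).2 hd
    exact ⟨(u, d.2), Prod.ext hu rfl⟩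

theorem map_dishat (h : G.IsClosure Q e₁ e₂ H ι a) (d : H.Dart) :
    dartMap ι (H.dishat d) = G.dishat (dartMap ι d) :=
  Prod.ext (h.map_dis d.1) rfl

theorem eq_or_eq (h : G.IsClosure Q e₁ e₂ H ι a) {d : H.Dart} (hd : dartMap ι d ∈ e₁ ∪ e₂) :
    d = a ∨ d = H.ferm a := by
  rcases hd with hm | hm
  · exact .inl (dartMap_injective h.inj
      (h.unique₁.unique ⟨hm, h.side _⟩ ⟨h.mem₁, h.side _⟩))
  · exact .inr (dartMap_injective h.inj
      (h.unique₂.unique ⟨hm, h.side _⟩ ⟨h.mem₂, h.side _⟩))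

theorem ferm_eq_of_map (h : G.IsClosure Q e₁ e₂ H ι a) {c d : H.Dart}
    (hcd : G.ferm (dartMap ι c) = dartMap ι d) : H.ferm c = d := by
  refine dartMap_injective h.inj ?_
  rw [← hcd]
  refine h.map_ferm c (h.notMem (h.side _) ?_)
  rw [hcd]
  exact h.side _

theorem eq_or_eq_of_leave (h : G.IsClosure Q e₁ e₂ H ι a) {d : H.Dart}
    (hd : ¬ Q (G.ferm (dartMap ι d)).1) : d = a ∨ d = H.ferm a := by
  refine h.eq_or_eq ?_
  by_contra hm
  exact hd ((h.ferm_iff _ hm).1 (h.side _))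

theorem conn0 (h : G.IsClosure Q e₁ e₂ H ι a) (hG : G.Conn0) : H.Conn0 := by
  have hs := H.reach0_equivalence
  have leave : ∀ (d : H.Dart), ¬ Q (G.ferm (dartMap ι d)).1 →
      Relation.ReflTransGen H.adj0 d.1 a.1 := by
    intro d hd
    rcases h.eq_or_eq_of_leave hd with rfl | rfl
    · exact .refl
    · exact hs.symm (.single (H.adj0_ferm a))
  intro v w
  refine (reflTransGen_lift_side (a := a.1) hs h.inj h.range_iff ?_ ?_ ?_
    (hG (ι v) (ι w))).1 w rfl
  · rintro u w ⟨m, m', -, hm⟩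
    have := h.ferm_eq_of_map (c := (u, m)) (d := (w, m')) hm
    exact .single ⟨m, m', by simp, this⟩
  · rintro u y ⟨m, m', -, hm⟩ hy
    refine leave (u, m) ?_
    change ¬ Q (G.ferm (ι u, m)).1
    rwa [hm]
  · rintro x w ⟨m, m', -, hm⟩ hx
    refine hs.symm (leave (w, m') ?_)
    change ¬ Q (G.ferm (ι w, m')).1
    rwa [← hm, G.ferm_invol]

theorem sameFace_lift (h : G.IsClosure Q e₁ e₂ H ι a) {c : H.Dart} {d : G.Dart}
    (hcd : G.SameFace (dartMap ι c) d) :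
    (∀ c', dartMap ι c' = d → H.SameFace c c') ∧ (¬ Q d.1 → H.SameFace c a) := by
  have hs := H.sameFace_equivalence
  have leave : ∀ (c : H.Dart) (y : G.Dart), G.FaceStep (dartMap ι c) y → ¬ Q y.1 →
      H.SameFace c a := by
    rintro c _ (rfl | rfl) hy
    · rcases h.eq_or_eq_of_leave hy with rfl | rfl
      · exact hs.refl _
      · exact H.sameFace_ferm a
    · exact absurd ((h.dis_iff _).1 (h.side c.1)) hy
  refine reflTransGen_lift_side (Q := fun d : G.Dart => Q d.1) hs (dartMap_injective h.inj)
    h.dart_range_iff ?_ leave ?_ hcd.reflTransGen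
  · rintro c c' (hc | hc)
    · rw [← h.ferm_eq_of_map hc]
      exact hs.symm (H.sameFace_ferm c)
    · rw [← h.map_dishat] at hc
      rw [← dartMap_injective h.inj hc]
      exact hs.symm (H.sameFace_dishat c)
  · intro x c hx hxQ
    refine hs.symm (leave c x ?_ hxQ)
    rcases hx with hx | hx
    · exact .inl (by rw [← hx, G.ferm_invol])
    · exact .inr (by rw [← hx, G.dishat_dishat])

theorem sameFace_map (h : G.IsClosure Q e₁ e₂ H ι a) (hface : G.LinesShareFace e₁ e₂)
    {c c' : H.Dart} (hc : H.SameFace c c') : G.SameFace (dartMap ι c) (dartMap ι c') := by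
  have hs := G.sameFace_equivalence
  have hab : G.SameFace (dartMap ι a) (dartMap ι (H.ferm a)) := by
    obtain ⟨x, hx, y, hy, hxy⟩ := hface
    exact hs.trans (h.line₁.sameFace h.mem₁ hx) (hs.trans hxy (h.line₂.sameFace hy h.mem₂))
  refine hc.of_equivalence (s := fun c c' => G.SameFace (dartMap ι c) (dartMap ι c'))
    ⟨fun _ => hs.refl _, fun h => hs.symm h, fun h h' => hs.trans h h'⟩ ?_ ?_
  · intro d
    by_cases hd : dartMap ι d ∈ e₁ ∪ e₂
    · rcases h.eq_or_eq hd with rfl | rfl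
      · exact hs.symm hab
      · rwa [H.ferm_invol]
    · rw [h.map_ferm d hd]
      exact G.sameFace_ferm _
  · intro d
    rw [h.map_dishat]
    exact G.sameFace_dishat _

/-- The map from the faces of a closure to the faces of the ambient graph. -/
def faceMap (h : G.IsClosure Q e₁ e₂ H ι a) (hface : G.LinesShareFace e₁ e₂) :
    MulAction.orbitRel.Quotient H.faceGroup H.Dart →
      MulAction.orbitRel.Quotient G.faceGroup G.Dart :=
  Quotient.map' (dartMap ι) fun _ _ hc => h.sameFace_map hface hc

theorem faceMap_injective (h : G.IsClosure Q e₁ e₂ H ι a) (hface : G.LinesShareFace e₁ e₂) :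
    Function.Injective (h.faceMap hface) := by
  rintro ⟨c⟩ ⟨c'⟩ hc
  exact Quotient.sound' ((h.sameFace_lift (Quotient.exact' hc)).1 c' rfl)

theorem card_faces {H' : PreGraph q} {ι' : H'.V → G.V} {a' : H'.Dart}
    (h : G.IsClosure Q e₁ e₂ H ι a) (h' : G.IsClosure (fun v => ¬ Q v) e₁ e₂ H' ι' a')
    (hface : G.LinesShareFace e₁ e₂) : G.F + 1 = H.F + H'.F := by
  refine card_add_one_of_cover (h.faceMap_injective hface) (h'.faceMap_injective hface)
    (c := Quotient.mk'' (dartMap ι a)) ?_ ?_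
  · refine Set.eq_univ_of_forall ?_
    rintro ⟨d⟩
    by_cases hd : Q d.1
    · obtain ⟨c, rfl⟩ := (h.dart_range_iff d).2 hd
      exact .inl ⟨Quotient.mk'' c, rfl⟩
    · obtain ⟨c, rfl⟩ := (h'.dart_range_iff d).2 hd
      exact .inr ⟨Quotient.mk'' c, rfl⟩
  · refine Set.Subset.antisymm ?_ (Set.singleton_subset_iff.2 ⟨⟨Quotient.mk'' a, rfl⟩,
      Quotient.mk'' a', Quotient.sound' (h.line₁.sameFace h'.mem₁ h.mem₁)⟩)
    rintro _ ⟨⟨⟨c⟩, rfl⟩, ⟨⟨c'⟩, hc'⟩⟩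
    have hcc' : G.SameFace (dartMap ι c) (dartMap ι' c') := Quotient.exact' hc'.symm
    exact Quotient.sound' (h.sameFace_map hface ((h.sameFace_lift hcc').2 (h'.side _)))

end IsClosure

end PreGraph

/-- A side closure of a side cut off by two lines comes with closure data. -/
theorem Graph.IsSideClose.exists_isClosure {G : Graph q} {Q : G.V → Prop}
    {e₁ e₂ : Set G.toPreGraph.Dart} {H : PreGraph q} (h : G.IsSideClose Q e₁ e₂ H)
    (hcut : G.toPreGraph.IsCutSide Q e₁ e₂) :
    ∃ ι a, G.toPreGraph.IsClosure Q e₁ e₂ H ι a := by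
  obtain ⟨ι, inj, range_iff, map_dis, ⟨a, _, mem₁, mem₂, rfl⟩, map_ferm⟩ := h
  exact ⟨ι, a, hcut, inj, range_iff, map_dis, mem₁, mem₂, map_ferm⟩

/-- Let `e₁ ≠ e₂` be fermionic lines of an SYK graph `G`
belonging to a common face, and let `V(G)` be partitioned into `V_L = {v | P v}`
and `V_R = {v | ¬ P v}` such that each of `e₁`, `e₂` has exactly one dart over
`V_L`, and no other fermionic line and no disorder line joins `V_L` to `V_R`.
Then the closures `HL` (on `V_L`) and `HR` (on `V_R`) are SYK graphs (their
fermionic multigraphs are connected) and `F(G) = F(HL) + F(HR) − 1`. -/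
theorem syk_face_count_splits_along_two_cut (q : ℕ) (hq : 2 ≤ q) (G : Graph q)
    (e₁ e₂ : Set G.toPreGraph.Dart)
    (h1 : G.toPreGraph.IsLine e₁) (h2 : G.toPreGraph.IsLine e₂)
    (hne : e₁ ≠ e₂) (hface : G.toPreGraph.LinesShareFace e₁ e₂)
    (P : G.V → Prop)
    (hE1 : ∃! d, d ∈ e₁ ∧ P d.1) (hE2 : ∃! d, d ∈ e₂ ∧ P d.1)
    (hferm : ∀ d : G.toPreGraph.Dart, d ∉ e₁ ∪ e₂ → (P d.1 ↔ P (G.ferm d).1))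
    (hdis : ∀ v : G.V, P v ↔ P (G.dis v)) :
    ∀ HL HR : PreGraph q,
      G.IsSideClose P e₁ e₂ HL → G.IsSideClose (fun v => ¬ P v) e₁ e₂ HR →
      HL.Conn0 ∧ HR.Conn0 ∧ G.toPreGraph.F + 1 = HL.F + HR.F := by
  intro HL HR hL hR
  have hcut : G.toPreGraph.IsCutSide P e₁ e₂ := ⟨h1, h2, hE1, hE2, hferm, hdis⟩
  obtain ⟨ιL, aL, hL⟩ := hL.exists_isClosure hcut
  obtain ⟨ιR, aR, hR⟩ := hR.exists_isClosure hcut.not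
  exact ⟨hL.conn0 G.conn, hR.conn0 G.conn, hL.card_faces hR hface⟩

end SYK
end
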